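/- Let m > 2 be an integer and let p_1, …, p_{m-1} ∈ (0,1) satisfy p_1 + ⋯ + p_{m-1} < 1; set p_m := 1 − (p_1 + ⋯ + p_{m-1}), and fix L > 0. For each N, let X^(N) be the length of a uniformly random stick after N stages of the fixed multi-proportion fragmentation, i.e. X^(N) = L·∏_{j=1}^{N} p_{w(j)} where w is chosen uniformly at random from the m^N functions w : {1,…,N} → {1,…,m}. If y_i = log_{10}(p_i/p_{i+1}) is irrational for some 1 ≤ i ≤ m−1, then the sequence {X^(N)} converges to strong Benford's law base 10. -/

import Mathlib

/-- The significand of a positive real `x` base 10: the unique `S ∈ [1,10)`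
with `x = S * 10^k` for some integer `k`. -/
noncomputable def signif (x : ℝ) : ℝ := (10 : ℝ) ^ Int.fract (Real.logb 10 x)

/-- The sequence of stick lengths after `N` stages of fixed multi-proportion
fragmentation with proportions `q : Fin m → ℝ` and initial length `L`
(the random stick is indexed by a uniformly random word `w : Fin N → Fin m`,
with length `L * ∏ j, q (w j)`) converges to strong Benford's law base 10:
for every `s ∈ [1,10]`, the probability that the significand is at most `s`
tends to `log₁₀ s`. -/
def StrongBenfordSticks (m : ℕ) (q : Fin m → ℝ) (L : ℝ) : Prop :=
  ∀ s ∈ Set.Icc (1 : ℝ) 10,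
    Filter.Tendsto
      (fun N : ℕ =>
        (Nat.card {w : Fin N → Fin m | signif (L * ∏ j, q (w j)) ≤ s} : ℝ) / (m : ℝ) ^ N)
      Filter.atTop (nhds (Real.logb 10 s))

/-- The full proportion vector `(p₁, …, p_{m-1}, 1 - (p₁ + ⋯ + p_{m-1}))`,
where `m = n + 1`. -/
noncomputable def fullProp {n : ℕ} (p : Fin n → ℝ) : Fin (n + 1) → ℝ :=
  Fin.snoc p (1 - ∑ i, p i)

open MeasureTheory Filter Topology BoundedContinuousFunction

instance UnitAddCircle.isProbabilityMeasure_volume :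
    IsProbabilityMeasure (volume : Measure UnitAddCircle) :=
  ⟨by simp⟩

instance UnitAddCircle.nullSingletonClass_volume :
    NullSingletonClass (volume : Measure UnitAddCircle) :=
  ⟨fun x => by
    have h := AddCircle.volume_closedBall (T := 1) (x := x) 0
    simpa using h⟩

/-- The uniform distribution on the unit circle. -/
noncomputable def UnitAddCircle.uniform : ProbabilityMeasure UnitAddCircle :=
  ⟨volume, inferInstance⟩

/-- **Weyl's criterion** for weak convergence to the uniform distribution on the circle. -/
theorem UnitAddCircle.tendsto_volume_of_tendsto_integral_fourier {ι : Type*} {l : Filter ι}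
    {μ : ι → ProbabilityMeasure UnitAddCircle}
    (h : ∀ k : ℤ, k ≠ 0 → Tendsto
      (fun i => ∫ x, fourier k x ∂(μ i : Measure UnitAddCircle)) l (𝓝 0)) :
    Tendsto μ l (𝓝 uniform) := by
  have hsurj : Function.Surjective
      (toContinuousMapStarₐ ℂ : (UnitAddCircle →ᵇ ℂ) →⋆ₐ[ℂ] C(UnitAddCircle, ℂ)) :=
    fun f => ⟨mkOfCompact f, rfl⟩
  refine ProbabilityMeasure.tendsto_of_tight_of_separatesPoints ℂ
    IsTightMeasureSet.of_compactSpace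
    (A := (fourierSubalgebra (T := (1 : ℝ))).comap (toContinuousMapStarₐ ℂ)) ?_ ?_
  · intro x y hxy
    obtain ⟨_, ⟨f, hf, rfl⟩, hne⟩ := fourierSubalgebra_separatesPoints (T := (1 : ℝ)) hxy
    obtain ⟨g, rfl⟩ := hsurj f
    exact ⟨_, ⟨_, ⟨g, hf, rfl⟩, rfl⟩, hne⟩
  · intro g hg
    have hg' : toContinuousMapStarₐ ℂ g ∈ Submodule.span ℂ (Set.range (@fourier 1)) := by
      rw [← fourierSubalgebra_coe]; exact hg
    have key : ∀ f ∈ Submodule.span ℂ (Set.range (@fourier 1)),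
        Tendsto (fun i => ∫ x, f x ∂(μ i : Measure UnitAddCircle)) l
          (𝓝 (∫ x, f x ∂(volume : Measure UnitAddCircle))) := by
      have hint : ∀ (ν : Measure UnitAddCircle) [IsProbabilityMeasure ν]
          (f : C(UnitAddCircle, ℂ)), Integrable f ν := fun ν _ f =>
        (mkOfCompact f).integrable ν
      intro f hf
      induction hf using Submodule.span_induction with
      | mem f hf =>
        obtain ⟨k, rfl⟩ := hf
        rcases eq_or_ne k 0 with rfl | hk
        · simpa using tendsto_const_nhds
        · rw [integral_eq_zero_of_add_right_eq_neg (fourier_add_half_inv_index hk one_pos)]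
          exact h k hk
      | zero => simpa using tendsto_const_nhds
      | add f g _ _ hf hg =>
        simpa [integral_add (hint _ f) (hint _ g)] using hf.add hg
      | smul c f _ hf =>
        simpa [integral_const_mul] using hf.const_mul c
    exact key _ hg'

theorem UnitAddCircle.isCompact_image_Icc (a b : ℝ) :
    IsCompact (((↑) : ℝ → UnitAddCircle) '' Set.Icc a b) :=
  isCompact_Icc.image (AddCircle.continuous_mk' 1)

theorem UnitAddCircle.coe_mem_image_Icc_iff {t : ℝ} (ht : t ≤ 1) (x : ℝ) :
    (x : UnitAddCircle) ∈ ((↑) : ℝ → UnitAddCircle) '' Set.Icc 0 t ↔ Int.fract x ≤ t := by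
  constructor
  · rintro ⟨y, ⟨hy0, hyt⟩, hyx⟩
    rcases (hyt.trans ht).lt_or_eq with hy1 | rfl
    · rw [← AddCircle.coe_fract x, AddCircle.coe_eq_coe_iff_of_mem_Ico (a := 0)
        ⟨hy0, by simpa using hy1⟩
        ⟨Int.fract_nonneg x, by simpa using Int.fract_lt_one x⟩] at hyx
      exact hyx ▸ hyt
    · exact (Int.fract_lt_one x).le.trans hyt
  · intro hx
    exact ⟨Int.fract x, ⟨Int.fract_nonneg x, hx⟩, AddCircle.coe_fract x⟩

theorem UnitAddCircle.volume_image_Icc {t : ℝ} (ht : t ≤ 1) :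
    volume (((↑) : ℝ → UnitAddCircle) '' Set.Icc 0 t) = ENNReal.ofReal t := by
  rw [AddCircle.add_projection_respects_measure 1 0 (isCompact_image_Icc 0 t).measurableSet]
  have h : (QuotientAddGroup.mk ⁻¹' (((↑) : ℝ → UnitAddCircle) '' Set.Icc 0 t) ∩
      Set.Ioc 0 (0 + 1) : Set ℝ) =ᵐ[volume] Set.Ioc 0 t := by
    have h1 : ∀ᵐ x : ℝ, x ≠ 1 := by simp [ae_iff]
    filter_upwards [h1] with x hx
    refine propext ((and_congr_left fun _ => coe_mem_image_Icc_iff ht x).trans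
      ⟨fun ⟨hxt, hx0, hx1⟩ => ?_, fun ⟨hx0, hxt⟩ => ?_⟩)
    · rw [zero_add] at hx1
      rw [Int.fract_eq_self.mpr ⟨hx0.le, hx1.lt_of_ne hx⟩] at hxt
      exact ⟨hx0, hxt⟩
    · have hx1 : x ≤ 1 := hxt.trans ht
      refine ⟨?_, hx0, by simpa using hx1⟩
      rwa [Int.fract_eq_self.mpr ⟨hx0.le, hx1.lt_of_ne hx⟩]
  rw [measure_congr h]
  simp

theorem UnitAddCircle.volume_frontier_image_Icc (a b : ℝ) :
    volume (frontier (((↑) : ℝ → UnitAddCircle) '' Set.Icc a b)) = 0 := by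
  refine measure_mono_null (t := {(a : UnitAddCircle), (b : UnitAddCircle)}) ?_
    (Set.Countable.measure_zero (Set.toFinite _).countable _)
  rw [(isCompact_image_Icc a b).isClosed.frontier_eq]
  rintro _ ⟨⟨x, hx, rfl⟩, hnot⟩
  by_contra hne
  simp only [Set.mem_insert_iff, Set.mem_singleton_iff, not_or] at hne
  refine hnot (mem_interior.mpr ⟨_, Set.image_mono Set.Ioo_subset_Icc_self,
    QuotientAddGroup.isOpenMap_coe _ isOpen_Ioo, x, ⟨hx.1.lt_of_ne ?_, hx.2.lt_of_ne ?_⟩, rfl⟩)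
  · rintro rfl; exact hne.1 rfl
  · rintro rfl; exact hne.2 rfl

theorem signif_le_iff {x s : ℝ} (hs : s ∈ Set.Icc (1 : ℝ) 10) :
    signif x ≤ s ↔ (Real.logb 10 x : UnitAddCircle) ∈
      ((↑) : ℝ → UnitAddCircle) '' Set.Icc 0 (Real.logb 10 s) := by
  have hs0 : 0 < s := one_pos.trans_le hs.1
  have hs1 : Real.logb 10 s ≤ 1 := by
    rw [Real.logb_le_iff_le_rpow (by norm_num) hs0]; simpa using hs.2
  rw [UnitAddCircle.coe_mem_image_Icc_iff hs1, Real.le_logb_iff_rpow_le (by norm_num) hs0, signif]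

/-- The norm of a sum of unit vectors that are not all equal is less than the number of vectors. -/
theorem norm_sum_lt_card_of_ne {E ι : Type*} [NormedAddCommGroup E] [NormedSpace ℝ E]
    [StrictConvexSpace ℝ E] [Fintype ι] {z : ι → E} (hz : ∀ i, ‖z i‖ = 1) {a b : ι}
    (hab : z a ≠ z b) : ‖∑ i, z i‖ < Fintype.card ι := by
  classical
  have hne : b ≠ a := fun h => hab (h ▸ rfl)
  have hb : b ∈ Finset.univ.erase a := by simp [hne]
  rw [← Finset.add_sum_erase _ _ (Finset.mem_univ a), ← Finset.add_sum_erase _ _ hb, ← add_assoc]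
  have h1 : ‖z a + z b‖ < 1 + 1 := by
    have h := norm_add_lt_of_not_sameRay (x := z a) (y := z b) fun h =>
      hab ((sameRay_iff_of_norm_eq ((hz a).trans (hz b).symm)).mp h)
    rwa [hz, hz] at h
  have h2 : ‖∑ i ∈ (Finset.univ.erase a).erase b, z i‖ ≤
      ((Finset.univ.erase a).erase b).card := by
    refine (norm_sum_le _ _).trans (by simp [hz])
  have h3 : (((Finset.univ.erase a).erase b).card : ℝ) + 1 + 1 = Fintype.card ι := by
    have h4 := Finset.card_erase_add_one hb
    have h5 := Finset.card_erase_add_one (Finset.mem_univ a)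
    rw [Finset.card_univ] at h5
    rw [← h5, ← h4]; push_cast; rfl
  calc _ ≤ ‖z a + z b‖ + ‖∑ i ∈ (Finset.univ.erase a).erase b, z i‖ := norm_add_le _ _
    _ < _ := by linarith

theorem fourier_coe_ne_of_irrational_sub {x y : ℝ} (h : Irrational (x - y)) {k : ℤ} (hk : k ≠ 0) :
    fourier k (x : UnitAddCircle) ≠ fourier k (y : UnitAddCircle) := by
  intro he
  rw [fourier_apply, fourier_apply] at he
  have h1 := AddCircle.injective_toCircle one_ne_zero (Circle.ext he)
  rw [← sub_eq_zero, ← smul_sub, ← AddCircle.coe_sub, ← AddCircle.coe_zsmul,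
    AddCircle.coe_eq_zero_iff] at h1
  obtain ⟨n, hn⟩ := h1
  refine (irrational_intCast_mul_iff.mpr ⟨hk, h⟩).ne_int n ?_
  simpa using hn.symm

theorem fourier_coe_sum {T : ℝ} {ι : Type*} (k : ℤ) (s : Finset ι) (f : ι → ℝ) :
    fourier k ((∑ i ∈ s, f i : ℝ) : AddCircle T) = ∏ i ∈ s, fourier k (f i : AddCircle T) := by
  simp only [fourier_coe_apply, ← Complex.exp_sum]
  push_cast
  rw [Finset.mul_sum, Finset.sum_div]

/-- The law of the image in the circle of the base 10 logarithm of a random stick length. -/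
noncomputable def stickLogLaw {m : ℕ} [NeZero m] (q : Fin m → ℝ) (L : ℝ) (N : ℕ) :
    ProbabilityMeasure UnitAddCircle :=
  ⟨(ProbabilityTheory.uniformOn (Set.univ : Set (Fin N → Fin m))).map
    fun w => (Real.logb 10 (L * ∏ j, q (w j)) : UnitAddCircle),
    Measure.isProbabilityMeasure_map (measurable_of_finite _).aemeasurable⟩

theorem stickLogLaw_apply {m : ℕ} [NeZero m] (q : Fin m → ℝ) (L : ℝ) (N : ℕ)
    {E : Set UnitAddCircle} (hE : MeasurableSet E) :
    (stickLogLaw q L N E : ℝ) =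
      (Nat.card {w : Fin N → Fin m | (Real.logb 10 (L * ∏ j, q (w j)) : UnitAddCircle) ∈ E} : ℝ) /
        (m : ℝ) ^ N := by
  change (Measure.map _ _ E).toReal = _
  rw [Measure.map_apply (measurable_of_finite _) hE, ProbabilityTheory.uniformOn_univ,
    Measure.count_apply_finite _ (Set.toFinite _), Nat.card_eq_card_finite_toFinset (Set.toFinite _)]
  simp [Set.preimage]

theorem integral_fourier_stickLogLaw {m : ℕ} [NeZero m] {q : Fin m → ℝ} (hq : ∀ i, 0 < q i)
    {L : ℝ} (hL : 0 < L) (N : ℕ) (k : ℤ) :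
    ∫ x, fourier k x ∂(stickLogLaw q L N : Measure UnitAddCircle) =
      fourier k (Real.logb 10 L : UnitAddCircle) *
        ((∑ i, fourier k (Real.logb 10 (q i) : UnitAddCircle)) / m) ^ N := by
  change ∫ x, fourier k x ∂(Measure.map _ _) = _
  have hw (w : Fin N → Fin m) : fourier k (Real.logb 10 (L * ∏ j, q (w j)) : UnitAddCircle) =
      fourier k (Real.logb 10 L : UnitAddCircle) *
        ∏ j, fourier k (Real.logb 10 (q (w j)) : UnitAddCircle) := by
    rw [Real.logb_mul hL.ne' (Finset.prod_ne_zero_iff.mpr fun j _ => (hq _).ne'),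
      Real.logb_prod _ _ fun j _ => (hq _).ne', AddCircle.coe_add, ← fourier_coe_sum]
    simp [fourier_apply, smul_add, AddCircle.toCircle_add]
  rw [integral_map (measurable_of_finite _).aemeasurable
    (map_continuous (fourier k)).aestronglyMeasurable, integral_fintype .of_finite]
  simp only [hw, Measure.real, ProbabilityTheory.uniformOn_univ, Measure.count_singleton]
  rw [← Finset.smul_sum, ← Finset.mul_sum, 
    ← Fintype.sum_pow fun i => fourier k (Real.logb 10 (q i) : UnitAddCircle), div_pow]
  simp
  ring

theorem strongBenfordSticks_of_irrational {m : ℕ} {q : Fin m → ℝ} (hq : ∀ i, 0 < q i)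
    {L : ℝ} (hL : 0 < L) {a b : Fin m} (hab : Irrational (Real.logb 10 (q a / q b))) :
    StrongBenfordSticks m q L := by
  have : NeZero m := ⟨fun h => (h ▸ a).elim0⟩
  rw [Real.logb_div (hq a).ne' (hq b).ne'] at hab
  have hlim : Tendsto (stickLogLaw q L) atTop (𝓝 UnitAddCircle.uniform) := by
    refine UnitAddCircle.tendsto_volume_of_tendsto_integral_fourier fun k hk => ?_
    simp only [integral_fourier_stickLogLaw hq hL]
    have hnorm : ‖(∑ i, fourier k (Real.logb 10 (q i) : UnitAddCircle)) / (m : ℂ)‖ < 1 := by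
      rw [norm_div, Complex.norm_natCast, div_lt_one (by exact_mod_cast NeZero.pos m)]
      have h := norm_sum_lt_card_of_ne
        (z := fun i => fourier k (Real.logb 10 (q i) : UnitAddCircle))
        (fun i => by rw [fourier_apply]; exact Circle.norm_coe _) (fourier_coe_ne_of_irrational_sub hab hk)
      simpa using h
    simpa using (tendsto_pow_atTop_nhds_zero_of_norm_lt_one hnorm).const_mul _
  intro s hs
  have hs1 : Real.logb 10 s ≤ 1 := by
    rw [Real.logb_le_iff_le_rpow (by norm_num) (one_pos.trans_le hs.1)]; simpa using hs.2
  have h := ProbabilityMeasure.tendsto_measure_of_null_frontier_of_tendsto hlim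
    ((ProbabilityMeasure.null_iff_toMeasure_null _ _).mpr
      (UnitAddCircle.volume_frontier_image_Icc 0 (Real.logb 10 s)))
  have h' := (NNReal.continuous_coe.tendsto _).comp h
  have hvol : ((UnitAddCircle.uniform
      (((↑) : ℝ → UnitAddCircle) '' Set.Icc 0 (Real.logb 10 s)) : NNReal) : ℝ) =
        Real.logb 10 s := by
    change (volume _).toReal = _
    rw [UnitAddCircle.volume_image_Icc hs1,
      ENNReal.toReal_ofReal (Real.logb_nonneg (by norm_num) hs.1)]
  rw [hvol] at h'
  refine h'.congr fun N => ?_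
  simp only [Function.comp_apply, signif_le_iff hs]
  exact stickLogLaw_apply q L N (UnitAddCircle.isCompact_image_Icc _ _).measurableSet

theorem fullProp_pos {n : ℕ} {p : Fin n → ℝ} (hp : ∀ i, 0 < p i) (hsum : ∑ i, p i < 1)
    (i : Fin (n + 1)) : 0 < fullProp p i := by
  refine Fin.lastCases ?_ (fun i => ?_) i
  · simpa [fullProp] using hsum
  · simpa [fullProp] using hp i

/-- Fixed multi-proportion stick fragmentation, Benford direction: with
`m = n + 1 > 2` proportions (the first `n` given, each in `(0,1)` with sum `< 1`,
the last defined as the complement) and initial length `L > 0`, if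
`yᵢ = log₁₀ (pᵢ / pᵢ₊₁)` is irrational for some `1 ≤ i ≤ m - 1`, then the lengths
of the sticks converge to strong Benford's law base 10. -/
theorem multiProportion_strongBenford (n : ℕ) (hn : 2 ≤ n)
    (p : Fin n → ℝ) (hp : ∀ i, p i ∈ Set.Ioo (0 : ℝ) 1)
    (hsum : ∑ i, p i < 1) (L : ℝ) (hL : 0 < L)
    (hirr : ∃ i : Fin n,
      Irrational (Real.logb 10 (fullProp p i.castSucc / fullProp p i.succ))) :
    StrongBenfordSticks (n + 1) (fullProp p) L := by
  obtain ⟨i, hi⟩ := hirr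
  exact strongBenfordSticks_of_irrational (fullProp_pos (fun i => (hp i).1) hsum) hL hi
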